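/- Let 0 < p < 1/2 and let f, g belong to L₁(K₀(px)dx). Then for every x > 0 the Parseval-type equality holds: (f∗g)(x) = (2/(xπ²)) ∫₀^∞ τ·sinh(πτ)·K_{iτ}(x)·(Ff)(τ)·(Fg)(τ) dτ. -/

import Mathlib

open MeasureTheory Real Set

/-- `K_{iτ}(x) = ∫₀^∞ exp(−x cosh u) cos(τu) du`. -/
noncomputable def Kib (τ x : ℝ) : ℝ :=
  ∫ u in Ioi (0:ℝ), Real.exp (-x * Real.cosh u) * Real.cos (τ * u)

/-- `K₀(x) = ∫₀^∞ exp(−x cosh u) du`. -/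
noncomputable def K0 (x : ℝ) : ℝ := ∫ u in Ioi (0:ℝ), Real.exp (-x * Real.cosh u)

/-- The Kontorovich–Lebedev transform. -/
noncomputable def KL (f : ℝ → ℂ) (τ : ℝ) : ℂ := ∫ x in Ioi (0:ℝ), (Kib τ x : ℂ) * f x

/-- The Kontorovich–Lebedev convolution. -/
noncomputable def KLconv (f g : ℝ → ℂ) (x : ℝ) : ℂ :=
  (1/(2*x) : ℂ) * ∫ y in Ioi (0:ℝ), ∫ t in Ioi (0:ℝ),
    (Real.exp (-((y^2+t^2)/(2*y*t))*x - y*t/(2*x)) : ℂ) * f y * g t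

section Auxiliary

open Complex Filter Topology
open scoped FourierTransform

lemma sq_div_four_le_cosh (u : ℝ) : u ^ 2 / 4 ≤ Real.cosh u := by
  rw [← Real.cosh_abs, ← sq_abs, Real.cosh_eq]
  have h := Real.quadratic_le_exp_of_nonneg (abs_nonneg u)
  have h' := Real.add_one_le_exp (-|u|)
  linarith

lemma integrable_exp_neg_mul_cosh {x : ℝ} (hx : 0 < x) :
    Integrable fun u : ℝ => Real.exp (-x * Real.cosh u) := by
  refine (integrable_exp_neg_mul_sq (b := x / 4) (by positivity)).mono' (by fun_prop) (.of_forall fun u => ?_)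
  rw [Real.norm_eq_abs, Real.abs_exp, Real.exp_le_exp]
  nlinarith [sq_div_four_le_cosh u]

lemma integral_ofReal_mul_cexp_of_even {h : ℝ → ℝ} (hi : Integrable h)
    (he : ∀ u, h (-u) = h u) (τ : ℝ) :
    ∫ u : ℝ, (h u : ℂ) * cexp (I * τ * u) =
      2 * ((∫ u in Ioi (0 : ℝ), h u * Real.cos (τ * u) : ℝ) : ℂ) := by
  have h_int : Integrable fun u : ℝ => (h u : ℂ) * cexp (I * τ * u) := by
    refine hi.ofReal.mul_bdd (c := 1) (by fun_prop) (.of_forall fun u => ?_)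
    rw [Complex.norm_exp]; simp
  have hneg : Integrable fun u : ℝ => (h u : ℂ) * cexp (-(I * τ * u)) := by
    refine hi.ofReal.mul_bdd (c := 1) (by fun_prop) (.of_forall fun u => ?_)
    rw [Complex.norm_exp]; simp
  rw [← integral_add_compl (s := Iic (0 : ℝ)) measurableSet_Iic h_int, compl_Iic]
  have h1 : ∫ u in Iic (0 : ℝ), (h u : ℂ) * cexp (I * τ * u) =
      ∫ u in Ioi (0 : ℝ), (h u : ℂ) * cexp (-(I * τ * u)) := by
    have := integral_comp_neg_Ioi (0 : ℝ) fun u : ℝ => (h u : ℂ) * cexp (I * τ * u)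
    rw [neg_zero] at this
    rw [← this]
    simp [he]
  rw [h1, ← integral_add hneg.integrableOn h_int.integrableOn, ← integral_complex_ofReal,
    ← integral_const_mul]
  congr 1 with u
  push_cast
  rw [Complex.cos]
  ring_nf

lemma integral_cexp_cosh (τ : ℝ) {x : ℝ} (hx : 0 < x) :
    ∫ u : ℝ, (Real.exp (-x * Real.cosh u) : ℂ) * cexp (I * τ * u) = 2 * (Kib τ x : ℂ) :=
  integral_ofReal_mul_cexp_of_even (integrable_exp_neg_mul_cosh hx) (by simp) τ

lemma integral_exp_neg_mul_cosh (x : ℝ) :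
    ∫ u : ℝ, Real.exp (-x * Real.cosh u) = 2 * K0 x := by
  rw [K0, ← integral_comp_abs (f := fun u => Real.exp (-x * Real.cosh u))]
  simp

lemma norm_cexp_cosh_shift (τ x u y : ℝ) :
    ‖cexp (-x * Complex.cosh (u + y * I) + I * τ * (u + y * I))‖ =
      Real.exp (-(x * Real.cos y) * Real.cosh u - τ * y) := by
  rw [Complex.norm_exp, Complex.cosh_add, Complex.cosh_mul_I, Complex.sinh_mul_I]
  congr 1
  simp [← Complex.ofReal_cosh, ← Complex.ofReal_sinh, ← Complex.ofReal_cos, ← Complex.ofReal_sin]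
  ring

lemma integrable_cexp_cosh_shift (τ : ℝ) {x δ : ℝ} (hx : 0 < x * Real.cos δ) :
    Integrable fun u : ℝ => cexp (-x * Complex.cosh (u + δ * I) + I * τ * (u + δ * I)) := by
  refine ((integrable_exp_neg_mul_cosh hx).mul_const (Real.exp (-(τ * δ)))).mono'
    (by fun_prop) (.of_forall fun u => ?_)
  rw [norm_cexp_cosh_shift, ← Real.exp_add, sub_eq_add_neg]

lemma tendsto_vertical_cexp_cosh (τ : ℝ) {x δ : ℝ} (hx : 0 < x) (hδ : 0 ≤ δ) (hδ' : δ < π / 2)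
    {s : ℝ → ℝ} (hs : ∀ T, Real.cosh (s T) = Real.cosh T) :
    Tendsto (fun T : ℝ => ∫ y in (0 : ℝ)..δ,
      cexp (-x * Complex.cosh ((s T : ℝ) + y * I) + I * τ * ((s T : ℝ) + y * I))) atTop (𝓝 0) := by
  have hc : 0 < Real.cos δ := Real.cos_pos_of_mem_Ioo ⟨by linarith [Real.pi_pos], hδ'⟩
  have hb : ∀ T : ℝ, ‖∫ y in (0 : ℝ)..δ,
      cexp (-x * Complex.cosh ((s T : ℝ) + y * I) + I * τ * ((s T : ℝ) + y * I))‖ ≤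
      Real.exp (-(x * Real.cos δ) * Real.cosh T + |τ| * δ) * |δ - 0| := by
    intro T
    refine intervalIntegral.norm_integral_le_of_norm_le_const fun y hy => ?_
    rw [uIoc_of_le hδ] at hy
    rw [norm_cexp_cosh_shift, hs, Real.exp_le_exp]
    have h1 : Real.cos δ ≤ Real.cos y :=
      Real.cos_le_cos_of_nonneg_of_le_pi hy.1.le (by linarith [Real.pi_pos]) hy.2
    have h2 : -(τ * y) ≤ |τ| * δ := by
      calc -(τ * y) ≤ |τ| * y := by nlinarith [neg_abs_le τ, hy.1]
        _ ≤ |τ| * δ := by gcongr; exact hy.2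
    have h3 : x * Real.cos δ * Real.cosh T ≤ x * Real.cos y * Real.cosh T := by
      have := Real.cosh_pos T
      gcongr
    linarith
  refine squeeze_zero_norm hb ?_
  have hcosh : Tendsto Real.cosh atTop atTop := by
    refine tendsto_atTop_mono sq_div_four_le_cosh ?_
    exact (tendsto_pow_atTop two_ne_zero).atTop_div_const four_pos
  have h1 : Tendsto (fun T => -(x * Real.cos δ) * Real.cosh T + |τ| * δ) atTop atBot :=
    tendsto_atBot_add_const_right _ _
      (hcosh.const_mul_atTop_of_neg (by nlinarith [mul_pos hx hc]))
  simpa using (Real.tendsto_exp_atBot.comp h1).mul_const |δ - 0|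

lemma integral_cexp_cosh_shift (τ : ℝ) {x δ : ℝ} (hx : 0 < x) (hδ : 0 ≤ δ) (hδ' : δ < π / 2) :
    ∫ u : ℝ, cexp (-x * Complex.cosh (u + δ * I) + I * τ * (u + δ * I)) = 2 * (Kib τ x : ℂ) := by
  have hc : 0 < Real.cos δ := Real.cos_pos_of_mem_Ioo ⟨by linarith [Real.pi_pos], hδ'⟩
  set F : ℂ → ℂ := fun z => cexp (-x * Complex.cosh z + I * τ * z) with hF
  have hrect : ∀ T : ℝ, (∫ u in (-T)..T, F (u + δ * I)) =
      (∫ u in (-T)..T, F u) + I * (∫ y in (0 : ℝ)..δ, F ((T : ℝ) + y * I)) -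
        I * ∫ y in (0 : ℝ)..δ, F ((-T : ℝ) + y * I) := by
    intro T
    have hd : Differentiable ℂ F := by
      intro z
      have := Complex.differentiable_cosh z
      simp only [hF]
      fun_prop
    have := integral_boundary_rect_eq_zero_of_differentiableOn F (-T) (T + δ * I)
      hd.differentiableOn
    simp at this
    push_cast
    linear_combination -this
  have hlim := intervalIntegral_tendsto_integral
    (integrable_cexp_cosh_shift τ (δ := δ) (mul_pos hx hc)) tendsto_neg_atTop_atBot tendsto_id
  have h0 : Integrable fun u : ℝ => F u := by
    simpa [hF] using integrable_cexp_cosh_shift τ (x := x) (δ := 0) (by simpa using hx)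
  have hlim0 := intervalIntegral_tendsto_integral h0 tendsto_neg_atTop_atBot tendsto_id
  have hv1 := (tendsto_vertical_cexp_cosh τ hx hδ hδ' (s := fun T => T) (fun _ => rfl)).const_mul I
  have hv2 := (tendsto_vertical_cexp_cosh τ hx hδ hδ' (s := fun T => -T) (by simp)).const_mul I
  have hlim' := (hlim0.add hv1).sub hv2
  have hval : ∫ u : ℝ, F u = 2 * (Kib τ x : ℂ) := by
    rw [← integral_cexp_cosh τ hx]
    congr 1 with u
    simp [hF, Complex.exp_add]
  rw [hval, mul_zero, add_zero, sub_zero] at hlim'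
  refine tendsto_nhds_unique hlim (hlim'.congr fun T => ?_)
  exact (hrect T).symm

/-- Exponential decay of `K_{iτ}(x)` in `τ`, from shifting the contour by `arccos p`. -/
lemma abs_Kib_le {p : ℝ} (hp : 0 < p) (hp1 : p ≤ 1) (τ : ℝ) {x : ℝ} (hx : 0 < x) :
    |Kib τ x| ≤ Real.exp (-(τ * arccos p)) * K0 (p * x) := by
  have hcos : Real.cos (arccos p) = p := Real.cos_arccos (by linarith) hp1
  have h := integral_cexp_cosh_shift τ hx (arccos_nonneg p) (arccos_lt_pi_div_two.2 hp)
  have h2 : ‖(2 * (Kib τ x : ℂ))‖ ≤ 2 * (Real.exp (-(τ * arccos p)) * K0 (p * x)) := by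
    rw [← h]
    refine (norm_integral_le_integral_norm _).trans_eq ?_
    simp_rw [norm_cexp_cosh_shift, hcos, sub_eq_add_neg, Real.exp_add]
    rw [integral_mul_const, mul_comm x p, integral_exp_neg_mul_cosh]
    ring
  rw [norm_mul, Complex.norm_real, Real.norm_eq_abs] at h2
  norm_num at h2
  exact h2

lemma log_sigmoid_sub_log_one_sub (u : ℝ) :
    Real.log (sigmoid u) - Real.log (1 - sigmoid u) = u := by
  have h := sigmoid_pos u
  rw [← sigmoid_neg, ← sigmoid_mul_rexp_neg, Real.log_mul h.ne' (Real.exp_pos _).ne', Real.log_exp]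
  ring

lemma integrable_sigmoid_mul_one_sub :
    Integrable fun u : ℝ => sigmoid u * (1 - sigmoid u) := by
  have h := integrableOn_image_iff_integrableOn_abs_deriv_smul (s := univ) MeasurableSet.univ
    (fun x _ => (hasDerivAt_sigmoid x).hasDerivWithinAt) sigmoid_injective.injOn
    (fun _ => (1 : ℝ))
  rw [image_univ, range_sigmoid] at h
  have h1 : IntegrableOn (fun _ : ℝ => (1 : ℝ)) (Ioo 0 1) := by simp
  have h2 := h.1 h1
  rw [integrableOn_univ] at h2
  refine h2.congr (.of_forall fun u => ?_)
  have := mul_pos (sigmoid_pos u) (sub_pos.2 (sigmoid_lt_one u))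
  simp [abs_of_pos this]

lemma integral_sigmoid_deriv_mul_cexp {τ : ℝ} (hτ : τ ≠ 0) :
    ∫ u : ℝ, ((sigmoid u * (1 - sigmoid u) : ℝ) : ℂ) * cexp (I * τ * u) =
      ((π * τ / Real.sinh (π * τ) : ℝ) : ℂ) := by
  have hbeta : Complex.betaIntegral (1 + I * τ) (1 - I * τ) =
      ((π * τ / Real.sinh (π * τ) : ℝ) : ℂ) := by
    have h := Complex.Gamma_mul_Gamma_eq_betaIntegral (s := 1 + I * τ) (t := 1 - I * τ)
      (by simp) (by simp)
    have h2 : (1 + I * τ + (1 - I * τ) : ℂ) = 2 := by ring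
    have hne : (I * τ : ℂ) ≠ 0 := by simp [hτ]
    rw [h2, Complex.Gamma_ofNat_eq_factorial] at h
    have h3 := Complex.Gamma_mul_Gamma_one_sub (I * τ)
    rw [add_comm, Complex.Gamma_add_one _ hne, mul_assoc, h3] at h
    have h4 : (π : ℂ) * (I * τ) = ((π * τ : ℝ) : ℂ) * I := by push_cast; ring
    rw [h4, Complex.sin_mul_I] at h
    have hs : Complex.sinh ((π * τ : ℝ) : ℂ) ≠ 0 := by
      rw [← Complex.ofReal_sinh, Complex.ofReal_ne_zero, Ne, Real.sinh_eq_zero]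
      exact mul_ne_zero Real.pi_ne_zero hτ
    norm_num at h
    rw [add_comm, ← h]
    push_cast at hs ⊢
    field_simp
  rw [← hbeta, Complex.betaIntegral, intervalIntegral.integral_of_le zero_le_one,
    integral_Ioc_eq_integral_Ioo, ← range_sigmoid, ← image_univ,
    integral_image_eq_integral_abs_deriv_smul MeasurableSet.univ
      (fun x _ => (hasDerivAt_sigmoid x).hasDerivWithinAt) sigmoid_injective.injOn,
    setIntegral_univ]
  congr 1 with u
  have h0 := sigmoid_pos u
  have h1 : 0 < 1 - sigmoid u := sub_pos.2 (sigmoid_lt_one u)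
  rw [abs_of_pos (mul_pos h0 h1), Complex.real_smul]
  congr 1
  have e1 : (1 + I * τ - 1 : ℂ) = I * τ := by ring
  have e2 : (1 - I * τ - 1 : ℂ) = -(I * τ) := by ring
  rw [e1, e2, ← Complex.ofReal_one, ← Complex.ofReal_sub,
    Complex.cpow_def_of_ne_zero (by exact_mod_cast h0.ne'),
    Complex.cpow_def_of_ne_zero (by exact_mod_cast h1.ne'), ← Complex.ofReal_log h0.le,
    ← Complex.ofReal_log h1.le, ← Complex.exp_add]
  congr 1
  have := congrArg (fun r : ℝ => (r : ℂ)) (log_sigmoid_sub_log_one_sub u)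
  push_cast at this ⊢
  rw [← this]
  ring

lemma sigmoid_add_sub_sigmoid_sub (u α : ℝ) :
    sigmoid (u + α) - sigmoid (u - α) = Real.sinh α * (Real.cosh α + Real.cosh u)⁻¹ := by
  have h1 : 0 < Real.cosh α + Real.cosh u := add_pos (Real.cosh_pos _) (Real.cosh_pos _)
  rw [sigmoid_def, sigmoid_def, eq_mul_inv_iff_mul_eq₀ h1.ne']
  have ha := Real.exp_pos α
  have hu := Real.exp_pos u
  rw [Real.sinh_eq, Real.cosh_eq, Real.cosh_eq, neg_add, neg_sub, Real.exp_add, Real.exp_sub,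
    Real.exp_neg, Real.exp_neg]
  field_simp
  ring

lemma integrable_inv_add_cosh {s : ℝ} (hs : 0 ≤ s) :
    Integrable fun u : ℝ => (s + Real.cosh u)⁻¹ := by
  refine (integrable_inv_one_add_sq.const_mul 5).mono' ?_ (.of_forall fun u => ?_)
  · refine Continuous.aestronglyMeasurable (Continuous.inv₀ (by fun_prop) fun u => ?_)
    have := Real.cosh_pos u
    positivity
  · have := Real.cosh_pos u
    rw [Real.norm_of_nonneg (by positivity), ← div_eq_mul_inv, inv_eq_one_div,
      div_le_div_iff₀ (by positivity) (by positivity)]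
    nlinarith [sq_div_four_le_cosh u, Real.one_le_cosh u]

lemma integral_inv_cosh_add_cosh_mul_cos {τ α : ℝ} (hτ : τ ≠ 0) (hα : 0 < α) :
    ∫ u in Ioi (0 : ℝ), (Real.cosh α + Real.cosh u)⁻¹ * Real.cos (τ * u) =
      π * Real.sin (τ * α) / (Real.sinh α * Real.sinh (π * τ)) := by
  have hsα : 0 < Real.sinh α := Real.sinh_pos_iff.2 hα
  have hT := (integrable_inv_add_cosh (Real.cosh_pos α).le).const_mul (Real.sinh α)
  have h := integral_ofReal_mul_cexp_of_even hT (by simp) τ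
  have hbdd : ∀ u : ℝ, ‖cexp (I * τ * u)‖ ≤ 1 := fun u => by
    rw [Complex.norm_exp]; simp
  set ρ : ℝ → ℝ := fun u => sigmoid u * (1 - sigmoid u) with hρ
  have hρi : Integrable ρ := integrable_sigmoid_mul_one_sub
  have hρτ : ∀ a : ℝ, Integrable fun u : ℝ => (ρ (u + a) : ℂ) * cexp (I * τ * u) := fun a =>
    (hρi.comp_add_right a).ofReal.mul_bdd (c := 1) (by fun_prop) (.of_forall hbdd)
  have hshift : ∀ a : ℝ, ∫ u : ℝ, (ρ (u + a) : ℂ) * cexp (I * τ * u) =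
      cexp (-(I * τ * a)) * ((π * τ / Real.sinh (π * τ) : ℝ) : ℂ) := by
    intro a
    rw [← integral_sigmoid_deriv_mul_cexp hτ, ← integral_const_mul,
      ← integral_add_right_eq_self (fun u : ℝ => cexp (-(I * τ * a)) *
        (((sigmoid u * (1 - sigmoid u) : ℝ) : ℂ) * cexp (I * τ * u))) a]
    congr 1 with u
    rw [mul_left_comm, ← Complex.exp_add]
    congr 2
    push_cast
    ring
  have hparts : ∫ u : ℝ, ((Real.sinh α * (Real.cosh α + Real.cosh u)⁻¹ : ℝ) : ℂ) *
      (cexp (I * τ * u) * (I * τ)) =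
      -∫ u : ℝ, ((ρ (u + α) - ρ (u + -α) : ℝ) : ℂ) * cexp (I * τ * u) := by
    refine integral_mul_deriv_eq_deriv_mul_of_integrable (fun u _ => ?_) (fun u _ => ?_) ?_ ?_ ?_
    · refine HasDerivAt.ofReal_comp (f := fun u =>
        Real.sinh α * (Real.cosh α + Real.cosh u)⁻¹) ?_
      simp_rw [← sigmoid_add_sub_sigmoid_sub]
      exact ((hasDerivAt_sigmoid (u + α)).comp_add_const u α).sub
        ((hasDerivAt_sigmoid (u - α)).comp_sub_const u α)
    · have h1 : HasDerivAt (fun z : ℂ => cexp (I * τ * z)) (cexp (I * τ * u) * (I * τ)) u := by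
        simpa using ((hasDerivAt_id (u : ℂ)).const_mul (I * τ)).cexp
      exact h1.comp_ofReal
    · refine hT.ofReal.mul_bdd (c := |τ|) (by fun_prop) (.of_forall fun u => ?_)
      rw [norm_mul]
      calc _ ≤ 1 * ‖I * (τ : ℂ)‖ := by gcongr; exact hbdd u
        _ = _ := by simp
    · exact ((hρi.comp_add_right α).sub (hρi.comp_add_right (-α))).ofReal.mul_bdd (c := 1)
        (by fun_prop) (.of_forall hbdd)
    · exact hT.ofReal.mul_bdd (c := 1) (by fun_prop) (.of_forall hbdd)
  simp_rw [← mul_assoc] at hparts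
  rw [integral_mul_const, integral_mul_const] at hparts
  simp_rw [Complex.ofReal_sub, sub_mul] at hparts
  rw [integral_sub (hρτ _) (hρτ _), hshift, hshift, h] at hparts
  have hsin : cexp (-(I * τ * α)) - cexp (-(I * τ * (-α : ℝ))) =
      -2 * I * (Real.sin (τ * α) : ℂ) := by
    push_cast
    rw [Complex.sin]
    ring_nf
    rw [Complex.I_sq]
    ring
  rw [← sub_mul, hsin] at hparts
  have hI : (I * τ : ℂ) ≠ 0 := by simp [hτ]
  have hfin : Real.sinh α * (∫ u in Ioi (0 : ℝ), (Real.cosh α + Real.cosh u)⁻¹ * Real.cos (τ * u)) *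
      τ = Real.sin (τ * α) * (π * τ / Real.sinh (π * τ)) := by
    rw [← integral_const_mul]
    simp_rw [← mul_assoc]
    have : (2 * I) * (((∫ u in Ioi (0 : ℝ), Real.sinh α * (Real.cosh α + Real.cosh u)⁻¹ *
      Real.cos (τ * u)) * τ : ℝ) : ℂ) =
      (2 * I) * ((Real.sin (τ * α) * (π * τ / Real.sinh (π * τ)) : ℝ) : ℂ) := by
      push_cast at hparts ⊢
      linear_combination hparts
    exact_mod_cast mul_left_cancel₀ (by simp) this
  have hsτ : Real.sinh (π * τ) ≠ 0 := by
    rw [Ne, Real.sinh_eq_zero]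
    exact mul_ne_zero Real.pi_ne_zero hτ
  field_simp at hfin ⊢
  linear_combination hfin

lemma integral_exp_neg_mul_Ioi {a : ℝ} (ha : 0 < a) :
    ∫ x in Ioi (0 : ℝ), Real.exp (-a * x) = a⁻¹ := by
  rw [integral_exp_mul_Ioi (by linarith)]
  simp [neg_div_neg_eq]

/-- The function `exp(-s x) exp(-x cosh u)` is integrable on the quarter plane. -/
lemma integrable_exp_mul_exp_cosh {s : ℝ} (hs : 0 ≤ s) :
    Integrable (fun z : ℝ × ℝ => Real.exp (-s * z.1) * Real.exp (-z.1 * Real.cosh z.2))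
      ((volume.restrict (Ioi 0)).prod (volume.restrict (Ioi 0))) := by
  have he : ∀ u x : ℝ, Real.exp (-s * x) * Real.exp (-x * Real.cosh u) =
      Real.exp (-(s + Real.cosh u) * x) := fun u x => by
    rw [← Real.exp_add]; ring_nf
  have hpos : ∀ u : ℝ, 0 < s + Real.cosh u := fun u => by
    have := Real.cosh_pos u
    positivity
  rw [integrable_prod_iff' (by fun_prop)]
  constructor
  · refine .of_forall fun u => ?_
    simp_rw [he]
    exact integrableOn_exp_mul_Ioi (by linarith [hpos u]) 0
  · refine (integrable_inv_add_cosh hs).integrableOn.congr (.of_forall fun u => ?_)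
    simp_rw [he, Real.norm_eq_abs, Real.abs_exp]
    exact (integral_exp_neg_mul_Ioi (hpos u)).symm

lemma integral_exp_mul_Kib (τ : ℝ) {s : ℝ} (hs : 0 ≤ s) :
    ∫ x in Ioi (0 : ℝ), Real.exp (-s * x) * Kib τ x =
      ∫ u in Ioi (0 : ℝ), (s + Real.cosh u)⁻¹ * Real.cos (τ * u) := by
  simp_rw [Kib, ← integral_const_mul, ← mul_assoc]
  rw [integral_integral_swap]
  · congr 1 with u
    rw [integral_mul_const]
    congr 1
    have := Real.cosh_pos u
    rw [← integral_exp_neg_mul_Ioi (a := s + Real.cosh u) (by positivity)]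
    congr 1 with x
    rw [← Real.exp_add]
    ring_nf
  · refine (integrable_exp_mul_exp_cosh hs).mul_bdd (c := 1) (by fun_prop)
      (.of_forall fun z => ?_)
    exact Real.abs_cos_le_one _

lemma integrableOn_exp_mul_K0 {s p : ℝ} (hs : 0 ≤ s) (hp : 0 < p) :
    IntegrableOn (fun x => Real.exp (-s * x) * K0 (p * x)) (Ioi 0) := by
  have h := (integrable_exp_mul_exp_cosh (s := s / p) (by positivity)).integral_prod_left
  simp_rw [integral_const_mul] at h
  have h2 := (integrableOn_Ioi_comp_mul_left_iff _ 0 hp).2 (by rw [mul_zero]; exact h)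
  refine h2.congr_fun (fun x _ => ?_) measurableSet_Ioi
  simp only [K0]
  congr 2
  field_simp

lemma mul_exp_neg_le_one (z : ℝ) : z * Real.exp (-z) ≤ 1 := by
  have h := Real.add_one_le_exp z
  rw [Real.exp_neg, ← div_eq_mul_inv, div_le_one (Real.exp_pos z)]
  linarith

lemma exp_neg_sub_div_mul_inv_le {c d σ : ℝ} (hc : 0 ≤ c) (hd : 0 < d) (hσ : 0 < σ) :
    Real.exp (-c * σ - d / σ) * σ⁻¹ ≤ d⁻¹ := by
  have h1 : Real.exp (-c * σ - d / σ) ≤ Real.exp (-(d / σ)) := by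
    rw [Real.exp_le_exp]
    nlinarith
  have h2 := mul_exp_neg_le_one (d / σ)
  calc _ ≤ Real.exp (-(d / σ)) * σ⁻¹ := by gcongr
    _ = (d / σ * Real.exp (-(d / σ))) * d⁻¹ := by field_simp
    _ ≤ 1 * d⁻¹ := by gcongr
    _ = d⁻¹ := one_mul _

lemma abs_sinh_le_cosh (w : ℝ) : |Real.sinh w| ≤ Real.cosh w := by
  rw [abs_le]
  constructor
  · linarith [Real.exp_pos w, Real.cosh_add_sinh w]
  · linarith [Real.exp_pos (-w), Real.cosh_sub_sinh w]

lemma abs_sinh_mul_exp_le {σ : ℝ} (hσ : 0 < σ) (w : ℝ) :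
    |Real.sinh w| * Real.exp (-σ * Real.cosh w) ≤
      2 * σ⁻¹ * Real.exp (-(1 / 2 * σ) * Real.cosh w) := by
  have h := mul_exp_neg_le_one (1 / 2 * σ * Real.cosh w)
  calc _ ≤ Real.cosh w * Real.exp (-σ * Real.cosh w) := by gcongr; exact abs_sinh_le_cosh w
    _ = 2 * σ⁻¹ * (1 / 2 * σ * Real.cosh w * Real.exp (-(1 / 2 * σ * Real.cosh w))) *
        Real.exp (-(1 / 2 * σ) * Real.cosh w) := by
      rw [show -σ * Real.cosh w = -(1 / 2 * σ * Real.cosh w) + -(1 / 2 * σ) * Real.cosh w by ring,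
        Real.exp_add]
      field_simp
    _ ≤ 2 * σ⁻¹ * 1 * Real.exp (-(1 / 2 * σ) * Real.cosh w) := by gcongr
    _ = _ := by ring

lemma integrable_sinh_mul_exp {σ : ℝ} (hσ : 0 < σ) :
    Integrable fun w : ℝ => Real.sinh w * Real.exp (-σ * Real.cosh w) := by
  refine ((integrable_exp_neg_mul_cosh (x := 1 / 2 * σ) (by positivity)).const_mul
    (2 * σ⁻¹)).mono' (by fun_prop) (.of_forall fun w => ?_)
  rw [norm_mul, Real.norm_eq_abs, Real.norm_eq_abs, Real.abs_exp]
  exact abs_sinh_mul_exp_le hσ w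

lemma K0_nonneg (x : ℝ) : 0 ≤ K0 x := integral_nonneg fun _ => (Real.exp_pos _).le

lemma integrable_exp_sub_div_mul_exp_cosh {c d q : ℝ} (hc : 0 ≤ c) (hd : 0 < d) (hq : 0 < q) :
    Integrable (fun z : ℝ × ℝ => Real.exp (-c * z.1 - d / z.1) * z.1⁻¹ *
      Real.exp (-(q * z.1) * Real.cosh z.2)) ((volume.restrict (Ioi 0)).prod volume) := by
  have hm : Measurable (fun z : ℝ × ℝ => Real.exp (-c * z.1 - d / z.1) * z.1⁻¹ *
      Real.exp (-(q * z.1) * Real.cosh z.2)) := by fun_prop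
  rw [integrable_prod_iff hm.aestronglyMeasurable]
  constructor
  · filter_upwards [ae_restrict_mem measurableSet_Ioi] with σ hσ
    exact (integrable_exp_neg_mul_cosh (mul_pos hq hσ)).const_mul _
  · have hK : IntegrableOn (fun σ => K0 (q * σ)) (Ioi 0) := by
      simpa using integrableOn_exp_mul_K0 le_rfl hq
    refine (Integrable.const_mul hK (2 * d⁻¹)).mono'
      hm.norm.aestronglyMeasurable.integral_prod_right' ?_
    filter_upwards [ae_restrict_mem measurableSet_Ioi] with σ hσ
    have hσ' : 0 < σ := hσ
    have h1 := exp_neg_sub_div_mul_inv_le hc hd hσ'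
    simp_rw [norm_mul, Real.norm_eq_abs, Real.abs_exp]
    rw [integral_const_mul, integral_exp_neg_mul_cosh, abs_of_pos (inv_pos.2 hσ'), abs_of_nonneg]
    · calc _ ≤ d⁻¹ * (2 * K0 (q * σ)) := by
            have := K0_nonneg (q * σ)
            gcongr
        _ = _ := by ring
    · have := K0_nonneg (q * σ)
      positivity

lemma integral_exp_cosh_add_cosh {y t : ℝ} (hy : 0 < y) (ht : 0 < t) (w : ℝ) :
    ∫ u : ℝ, Real.exp (-y * Real.cosh u) * Real.exp (-t * Real.cosh (w - u)) =
      ∫ σ in Ioi (0 : ℝ), Real.exp (-((y ^ 2 + t ^ 2) / (2 * y * t)) * σ - y * t / 2 / σ) * σ⁻¹ *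
        Real.exp (-σ * Real.cosh w) := by
  have hw := Real.exp_pos w
  set a := y * t / (y + t * Real.exp w) with ha
  have ha0 : 0 < a := by positivity
  have himg : (fun u : ℝ => a * Real.exp u) '' univ = Ioi 0 := by
    ext σ
    simp only [image_univ, mem_range, mem_Ioi]
    constructor
    · rintro ⟨u, rfl⟩
      positivity
    · intro hσ
      refine ⟨Real.log (σ / a), ?_⟩
      rw [Real.exp_log (by positivity)]
      field_simp
  have hder : ∀ u ∈ (univ : Set ℝ),
      HasDerivWithinAt (fun u : ℝ => a * Real.exp u) (a * Real.exp u) univ u := fun u _ =>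
    ((Real.hasDerivAt_exp u).const_mul a).hasDerivWithinAt
  have hinj : InjOn (fun u : ℝ => a * Real.exp u) univ := fun u _ v _ h =>
    Real.exp_injective (mul_left_cancel₀ ha0.ne' h)
  rw [← himg, integral_image_eq_integral_abs_deriv_smul MeasurableSet.univ hder hinj,
    setIntegral_univ]
  congr 1 with u
  have hu := Real.exp_pos u
  rw [abs_of_pos (by positivity), smul_eq_mul]
  have : ∀ A B C : ℝ, 0 < A → A * (B * A⁻¹ * C) = B * C := fun A B C hA => by field_simp
  rw [this _ _ _ (by positivity), ← Real.exp_add, ← Real.exp_add]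
  congr 1
  rw [Real.cosh_eq, Real.cosh_eq, Real.cosh_eq, neg_sub, Real.exp_sub, Real.exp_sub, Real.exp_neg,
    Real.exp_neg, ha]
  field_simp
  ring

lemma norm_cexp_I_mul_le (τ w : ℝ) : ‖cexp (I * τ * w)‖ ≤ 1 := by
  rw [Complex.norm_exp]; simp

/-- Macdonald's formula for the product of two modified Bessel functions. -/
lemma Kib_mul_Kib (τ : ℝ) {y t : ℝ} (hy : 0 < y) (ht : 0 < t) :
    ∫ σ in Ioi (0 : ℝ), Real.exp (-((y ^ 2 + t ^ 2) / (2 * y * t)) * σ - y * t / 2 / σ) * σ⁻¹ *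
      Kib τ σ = 2 * (Kib τ y * Kib τ t) := by
  set c := (y ^ 2 + t ^ 2) / (2 * y * t) with hc
  have hc0 : 0 ≤ c := by positivity
  have h_int : ∀ {y : ℝ}, 0 < y →
      Integrable fun u : ℝ => (Real.exp (-y * Real.cosh u) : ℂ) * cexp (I * τ * u) := fun hy =>
    (integrable_exp_neg_mul_cosh hy).ofReal.mul_bdd (c := 1) (by fun_prop)
      (.of_forall (norm_cexp_I_mul_le τ))
  have hconv := integral_convolution (μ := volume) (ν := volume) (ContinuousLinearMap.mul ℝ ℂ)
    (h_int hy) (h_int ht)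
  rw [integral_cexp_cosh τ hy, integral_cexp_cosh τ ht] at hconv
  have hΦ : ∀ w : ℝ, convolution (fun u : ℝ => (Real.exp (-y * Real.cosh u) : ℂ) * cexp (I * τ * u))
      (fun u : ℝ => (Real.exp (-t * Real.cosh u) : ℂ) * cexp (I * τ * u))
      (ContinuousLinearMap.mul ℝ ℂ) volume w =
      ∫ σ in Ioi (0 : ℝ), ((Real.exp (-c * σ - y * t / 2 / σ) * σ⁻¹ *
        Real.exp (-(1 * σ) * Real.cosh w) : ℝ) : ℂ) * cexp (I * τ * w) := by
    intro w
    rw [integral_mul_const, integral_complex_ofReal]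
    simp_rw [one_mul]
    rw [← integral_exp_cosh_add_cosh hy ht w, ← integral_complex_ofReal, ← integral_mul_const,
      convolution]
    congr 1 with u
    rw [ContinuousLinearMap.mul_apply']
    have : cexp (I * τ * w) = cexp (I * τ * u) * cexp (I * τ * (w - u : ℝ)) := by
      rw [← Complex.exp_add]; push_cast; ring_nf
    rw [this]
    push_cast
    ring
  simp_rw [hΦ] at hconv
  rw [integral_integral_swap] at hconv
  · simp_rw [Complex.ofReal_mul, mul_assoc] at hconv
    simp_rw [integral_const_mul] at hconv
    have hK : ∀ σ ∈ Ioi (0 : ℝ), ((Real.exp (-c * σ - y * t / 2 / σ) : ℝ) : ℂ) *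
        (((σ⁻¹ : ℝ) : ℂ) * ∫ w : ℝ, ((Real.exp (-(1 * σ) * Real.cosh w) : ℝ) : ℂ) *
          cexp (I * (τ * w))) =
        2 * ((Real.exp (-c * σ - y * t / 2 / σ) * σ⁻¹ * Kib τ σ : ℝ) : ℂ) := by
      intro σ hσ
      have := integral_cexp_cosh τ hσ
      simp_rw [one_mul, ← mul_assoc I]
      rw [this]
      push_cast
      ring
    rw [setIntegral_congr_fun measurableSet_Ioi hK, integral_const_mul,
      integral_complex_ofReal] at hconv
    simp only [ContinuousLinearMap.mul_apply'] at hconv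
    have h2 : (∫ σ in Ioi (0 : ℝ), Real.exp (-c * σ - y * t / 2 / σ) * σ⁻¹ * Kib τ σ : ℝ) * 2 =
      2 * Kib τ y * (2 * Kib τ t) := by
      rw [mul_comm]
      exact_mod_cast hconv
    linarith
  · have := (integrable_exp_sub_div_mul_exp_cosh hc0 (d := y * t / 2) (by positivity)
      one_pos).swap.ofReal (𝕜 := ℂ)
    refine this.mul_bdd (c := 1) (by fun_prop) (.of_forall fun z => norm_cexp_I_mul_le τ z.1)

lemma integral_sinh_mul_cexp (τ : ℝ) {σ : ℝ} (hσ : 0 < σ) :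
    ∫ w : ℝ, ((Real.sinh w * Real.exp (-σ * Real.cosh w) : ℝ) : ℂ) * cexp (I * τ * w) =
      I * τ * σ⁻¹ * (2 * Kib τ σ) := by
  have hS := integrable_sinh_mul_exp hσ
  have hE := integrable_exp_neg_mul_cosh hσ
  have hparts : ∫ w : ℝ, ((Real.exp (-σ * Real.cosh w) : ℝ) : ℂ) * (cexp (I * τ * w) * (I * τ)) =
      -∫ w : ℝ, ((Real.exp (-σ * Real.cosh w) * (-σ * Real.sinh w) : ℝ) : ℂ) *
        cexp (I * τ * w) := by
    refine integral_mul_deriv_eq_deriv_mul_of_integrable (fun u _ => ?_) (fun u _ => ?_) ?_ ?_ ?_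
    · refine HasDerivAt.ofReal_comp (f := fun w => Real.exp (-σ * Real.cosh w)) ?_
      exact ((Real.hasDerivAt_cosh u).const_mul (-σ)).exp
    · have h1 : HasDerivAt (fun z : ℂ => cexp (I * τ * z)) (cexp (I * τ * u) * (I * τ)) u := by
        simpa using ((hasDerivAt_id (u : ℂ)).const_mul (I * τ)).cexp
      exact h1.comp_ofReal
    · refine hE.ofReal.mul_bdd (c := |τ|) (by fun_prop) (.of_forall fun u => ?_)
      rw [norm_mul]
      calc _ ≤ 1 * ‖I * (τ : ℂ)‖ := by gcongr; exact norm_cexp_I_mul_le τ u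
        _ = _ := by simp
    · have hS' := (hS.const_mul (-σ)).congr (.of_forall fun w =>
        show _ = Real.exp (-σ * Real.cosh w) * (-σ * Real.sinh w) by ring)
      exact hS'.ofReal.mul_bdd (c := 1) (by fun_prop) (.of_forall (norm_cexp_I_mul_le τ))
    · exact hE.ofReal.mul_bdd (c := 1) (by fun_prop) (.of_forall (norm_cexp_I_mul_le τ))
  simp_rw [← mul_assoc] at hparts
  rw [integral_mul_const, integral_mul_const, integral_cexp_cosh τ hσ] at hparts
  have h1 : ∫ w : ℝ, ((Real.exp (-σ * Real.cosh w) * (-σ) * Real.sinh w : ℝ) : ℂ) *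
        cexp (I * τ * w) = -σ * ∫ w : ℝ, ((Real.sinh w * Real.exp (-σ * Real.cosh w) : ℝ) : ℂ) *
        cexp (I * τ * w) := by
    rw [← integral_const_mul]
    congr 1 with w
    push_cast
    ring
  have hσ' : (σ : ℂ) ≠ 0 := by exact_mod_cast hσ.ne'
  have h2 : ∀ X : ℂ, 2 * (Kib τ σ : ℂ) * I * τ = -(-σ * X) →
      X = I * τ * ((σ⁻¹ : ℝ) : ℂ) * (2 * Kib τ σ) := fun X hX => by
    push_cast
    field_simp
    linear_combination -hX
  exact h2 _ (by rw [← h1]; exact hparts)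

lemma integral_ofReal_mul_cexp_of_odd {h : ℝ → ℝ} (hi : Integrable h)
    (ho : ∀ u, h (-u) = -h u) (τ : ℝ) :
    ∫ u : ℝ, (h u : ℂ) * cexp (I * τ * u) =
      2 * I * ((∫ u in Ioi (0 : ℝ), h u * Real.sin (τ * u) : ℝ) : ℂ) := by
  have h_int : Integrable fun u : ℝ => (h u : ℂ) * cexp (I * τ * u) :=
    hi.ofReal.mul_bdd (c := 1) (by fun_prop) (.of_forall (norm_cexp_I_mul_le τ))
  have hneg : Integrable fun u : ℝ => -((h u : ℂ) * cexp (-(I * τ * u))) := by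
    refine (hi.ofReal.mul_bdd (c := 1) (by fun_prop) (.of_forall fun u => ?_)).neg
    rw [Complex.norm_exp]; simp
  rw [← integral_add_compl (s := Iic (0 : ℝ)) measurableSet_Iic h_int, compl_Iic]
  have h1 : ∫ u in Iic (0 : ℝ), (h u : ℂ) * cexp (I * τ * u) =
      ∫ u in Ioi (0 : ℝ), -((h u : ℂ) * cexp (-(I * τ * u))) := by
    have := integral_comp_neg_Ioi (0 : ℝ) fun u : ℝ => (h u : ℂ) * cexp (I * τ * u)
    rw [neg_zero] at this
    rw [← this]
    simp [ho]
  rw [h1, ← integral_add hneg.integrableOn h_int.integrableOn, ← integral_complex_ofReal,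
    ← integral_const_mul]
  congr 1 with u
  push_cast
  rw [Complex.sin]
  ring_nf
  rw [Complex.I_sq]
  ring_nf

/-- Fourier inversion for the kernel `exp(iτw)`. -/
lemma integral_mul_cexp_neg_of_integral_mul_cexp {Ψ h : ℝ → ℂ} (hΨc : Continuous Ψ)
    (hΨ : Integrable Ψ) (hh : Integrable h) (hΨh : ∀ τ : ℝ, ∫ w : ℝ, Ψ w * cexp (I * τ * w) = h τ)
    (α : ℝ) : ∫ τ : ℝ, h τ * cexp (-(I * τ * α)) = 2 * π * Ψ α := by
  have hF : 𝓕 Ψ = fun ξ : ℝ => h (-(2 * π) * ξ) := by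
    ext ξ
    rw [Real.fourier_real_eq_integral_exp_smul, ← hΨh]
    congr 1 with w
    rw [smul_eq_mul, mul_comm]
    push_cast
    ring_nf
  have hne : -(2 * π) ≠ 0 := neg_ne_zero.2 Real.two_pi_pos.ne'
  have hFi : Integrable (𝓕 Ψ) := by
    rw [hF]
    exact hh.comp_mul_left' hne
  have hinv := congrFun (hΨc.fourierInv_fourier_eq hΨ hFi) α
  rw [Real.fourierInv_eq', hF] at hinv
  have hsub := Measure.integral_comp_mul_left (fun τ : ℝ => h τ * cexp (-(I * τ * α))) (-(2 * π))
  have heq : (∫ ξ : ℝ, h (-(2 * π) * ξ) * cexp (-(I * ((-(2 * π) * ξ : ℝ) : ℂ) * α))) = Ψ α := by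
    rw [← hinv]
    congr 1 with ξ
    rw [smul_eq_mul, mul_comm]
    congr 2
    simp
    ring
  rw [heq, inv_neg, abs_neg, abs_of_pos (inv_pos.2 Real.two_pi_pos), Complex.real_smul] at hsub
  rw [hsub]
  have : (π : ℂ) ≠ 0 := by exact_mod_cast Real.pi_ne_zero
  generalize (∫ τ : ℝ, h τ * cexp (-(I * τ * α))) = X
  push_cast
  field_simp

lemma measurable_Kib : Measurable fun z : ℝ × ℝ => Kib z.1 z.2 := by
  have : StronglyMeasurable fun q : (ℝ × ℝ) × ℝ =>
      Real.exp (-q.1.2 * Real.cosh q.2) * Real.cos (q.1.1 * q.2) :=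
    (by fun_prop : Continuous _).stronglyMeasurable
  exact this.integral_prod_right.measurable

lemma Kib_neg (τ x : ℝ) : Kib (-τ) x = Kib τ x := by simp [Kib]

lemma Kib_abs (τ x : ℝ) : Kib |τ| x = Kib τ x := by
  rcases abs_choice τ with h | h <;> rw [h]
  exact Kib_neg τ x

lemma pi_div_three_lt_arccos {p : ℝ} (hp0 : 0 < p) (hp : p < 1 / 2) : π / 3 < arccos p := by
  have h : arccos (1 / 2) = π / 3 := by
    rw [← Real.cos_pi_div_three, Real.arccos_cos (by positivity) (by linarith [Real.pi_pos])]
  rw [← h]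
  exact Real.strictAntiOn_arccos ⟨by linarith, by linarith⟩ ⟨by norm_num, by norm_num⟩ hp

lemma exp_neg_abs_le (τ : ℝ) : Real.exp (-|τ|) ≤ 2 * (1 + τ ^ 2)⁻¹ := by
  have h := Real.quadratic_le_exp_of_nonneg (abs_nonneg τ)
  rw [sq_abs] at h
  rw [Real.exp_neg, ← div_eq_mul_inv, inv_eq_one_div, div_le_div_iff₀ (Real.exp_pos _)
    (by positivity)]
  nlinarith [abs_nonneg τ]

lemma integrable_mul_Kib_mul_Kib {y t : ℝ} (hy : 0 < y) (ht : 0 < t) :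
    Integrable fun τ : ℝ => τ * (Kib τ y * Kib τ t) := by
  have hm : Measurable fun τ : ℝ => τ * (Kib τ y * Kib τ t) := by
    have h1 : ∀ x : ℝ, Measurable fun τ => Kib τ x := fun x =>
      measurable_Kib.comp (measurable_id.prodMk measurable_const)
    exact measurable_id.mul ((h1 y).mul (h1 t))
  refine (integrable_inv_one_add_sq.const_mul (2 * (K0 (1 / 4 * y) * K0 (1 / 4 * t)))).mono'
    hm.aestronglyMeasurable (.of_forall fun τ => ?_)
  have hδ : 1 ≤ arccos (1 / 4) := by
    have := pi_div_three_lt_arccos (p := 1 / 4) (by norm_num) (by norm_num)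
    linarith [Real.pi_gt_three]
  have hK : ∀ {x : ℝ}, 0 < x → |Kib τ x| ≤ Real.exp (-|τ|) * K0 (1 / 4 * x) := by
    intro x hx
    rw [← Kib_abs]
    refine (abs_Kib_le (p := 1 / 4) (by norm_num) (by norm_num) |τ| hx).trans ?_
    have := K0_nonneg (1 / 4 * x)
    gcongr
    exact le_mul_of_one_le_right (abs_nonneg τ) hδ
  have h1 := mul_exp_neg_le_one |τ|
  have h2 := exp_neg_abs_le τ
  have hy0 := K0_nonneg (1 / 4 * y)
  have ht0 := K0_nonneg (1 / 4 * t)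
  rw [norm_mul, norm_mul, Real.norm_eq_abs, Real.norm_eq_abs, Real.norm_eq_abs]
  calc |τ| * (|Kib τ y| * |Kib τ t|)
      ≤ |τ| * ((Real.exp (-|τ|) * K0 (1 / 4 * y)) * (Real.exp (-|τ|) * K0 (1 / 4 * t))) := by
        gcongr
        exacts [hK hy, hK ht]
    _ = (|τ| * Real.exp (-|τ|)) * Real.exp (-|τ|) * (K0 (1 / 4 * y) * K0 (1 / 4 * t)) := by ring
    _ ≤ 1 * (2 * (1 + τ ^ 2)⁻¹) * (K0 (1 / 4 * y) * K0 (1 / 4 * t)) := by gcongr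
    _ = _ := by ring

lemma integrableOn_exp_sub_div {c d : ℝ} (hc : 0 < c) (hd : 0 ≤ d) :
    IntegrableOn (fun σ : ℝ => Real.exp (-c * σ - d / σ)) (Ioi 0) := by
  refine Integrable.mono' (integrableOn_exp_mul_Ioi (a := -c) (by linarith) 0)
    (by fun_prop : Measurable _).aestronglyMeasurable ?_
  filter_upwards [ae_restrict_mem measurableSet_Ioi] with σ hσ
  have hσ' : 0 < σ := hσ
  rw [Real.norm_eq_abs, Real.abs_exp, Real.exp_le_exp]
  have : 0 ≤ d / σ := by positivity
  linarith

lemma integrable_exp_sub_div_mul_sinh {c d : ℝ} (hc : 0 < c) (hd : 0 < d) :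
    Integrable (fun z : ℝ × ℝ => Real.exp (-c * z.1 - d / z.1) *
      (Real.sinh z.2 * Real.exp (-z.1 * Real.cosh z.2))) ((volume.restrict (Ioi 0)).prod volume) := by
  have h := (integrable_exp_sub_div_mul_exp_cosh hc.le hd (q := 1 / 2) (by norm_num)).const_mul 2
  refine h.mono' (by fun_prop : Measurable _).aestronglyMeasurable ?_
  have hpos : ∀ᵐ z : ℝ × ℝ ∂((volume.restrict (Ioi 0)).prod volume), z.1 ∈ Ioi (0 : ℝ) :=
    Measure.quasiMeasurePreserving_fst.ae (ae_restrict_mem measurableSet_Ioi)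
  filter_upwards [hpos] with z hz
  have hb := abs_sinh_mul_exp_le hz z.2
  rw [norm_mul, norm_mul, Real.norm_eq_abs, Real.norm_eq_abs, Real.norm_eq_abs, Real.abs_exp,
    Real.abs_exp]
  calc _ ≤ Real.exp (-c * z.1 - d / z.1) *
        (2 * z.1⁻¹ * Real.exp (-(1 / 2 * z.1) * Real.cosh z.2)) := by gcongr
    _ = _ := by ring

lemma integral_mul_Kib_mul_Kib_mul_sin {y t : ℝ} (hy : 0 < y) (ht : 0 < t) (α : ℝ) :
    ∫ τ in Ioi (0 : ℝ), τ * (Kib τ y * Kib τ t) * Real.sin (τ * α) =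
      π / 4 * (Real.sinh α * ∫ σ in Ioi (0 : ℝ),
        Real.exp (-((y ^ 2 + t ^ 2) / (2 * y * t)) * σ - y * t / 2 / σ) *
          Real.exp (-σ * Real.cosh α)) := by
  set c := (y ^ 2 + t ^ 2) / (2 * y * t) with hc
  set d := y * t / 2 with hd
  have hc0 : 0 < c := by positivity
  have hd0 : 0 < d := by positivity
  set Λ : ℝ → ℝ := fun w => ∫ σ in Ioi (0 : ℝ), Real.exp (-c * σ - d / σ) *
    Real.exp (-σ * Real.cosh w) with hΛ
  have hI := integrable_exp_sub_div_mul_sinh hc0 hd0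
  have hΨ : ∀ w : ℝ, Real.sinh w * Λ w = ∫ σ in Ioi (0 : ℝ), Real.exp (-c * σ - d / σ) *
      (Real.sinh w * Real.exp (-σ * Real.cosh w)) := fun w => by
    rw [hΛ, ← integral_const_mul]
    congr 1 with σ
    ring
  have hΨi : Integrable fun w : ℝ => Real.sinh w * Λ w := by
    simp_rw [hΨ]
    exact hI.integral_prod_right
  have hΛc : Continuous Λ := by
    refine continuous_of_dominated (bound := fun σ => Real.exp (-c * σ - d / σ))
      (fun w => (by fun_prop : Measurable _).aestronglyMeasurable) (fun w => ?_)
      (integrableOn_exp_sub_div hc0 hd0.le) (.of_forall fun σ => by fun_prop)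
    filter_upwards [ae_restrict_mem measurableSet_Ioi] with σ hσ
    have hσ' : 0 < σ := hσ
    rw [norm_mul, Real.norm_eq_abs, Real.norm_eq_abs, Real.abs_exp, Real.abs_exp]
    refine mul_le_of_le_one_right (Real.exp_pos _).le (Real.exp_le_one_iff.2 ?_)
    have := Real.cosh_pos w
    nlinarith [mul_pos hσ' this]
  have hFT : ∀ τ : ℝ, ∫ w : ℝ, ((Real.sinh w * Λ w : ℝ) : ℂ) * cexp (I * τ * w) =
      4 * I * ((τ * (Kib τ y * Kib τ t) : ℝ) : ℂ) := by
    intro τ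
    have h1 : ∀ w : ℝ, ((Real.sinh w * Λ w : ℝ) : ℂ) * cexp (I * τ * w) =
        ∫ σ in Ioi (0 : ℝ), ((Real.exp (-c * σ - d / σ) *
          (Real.sinh w * Real.exp (-σ * Real.cosh w)) : ℝ) : ℂ) * cexp (I * τ * w) := fun w => by
      rw [hΨ, integral_mul_const, integral_complex_ofReal]
    simp_rw [h1]
    rw [integral_integral_swap]
    · have h2 : ∀ σ ∈ Ioi (0 : ℝ), ∫ w : ℝ, ((Real.exp (-c * σ - d / σ) *
          (Real.sinh w * Real.exp (-σ * Real.cosh w)) : ℝ) : ℂ) * cexp (I * τ * w) =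
          2 * I * τ * ((Real.exp (-c * σ - d / σ) * σ⁻¹ * Kib τ σ : ℝ) : ℂ) := by
        intro σ hσ
        have := integral_sinh_mul_cexp τ hσ
        simp_rw [Complex.ofReal_mul (Real.exp (-c * σ - d / σ)), mul_assoc (Complex.ofReal _)]
        rw [integral_const_mul, this]
        push_cast
        ring
      rw [setIntegral_congr_fun measurableSet_Ioi h2, integral_const_mul, integral_complex_ofReal,
        Kib_mul_Kib τ hy ht]
      push_cast
      ring
    · exact (hI.swap.ofReal (𝕜 := ℂ)).mul_bdd (c := 1) (by fun_prop)
        (.of_forall fun z => norm_cexp_I_mul_le τ z.1)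
  have hodd := integrable_mul_Kib_mul_Kib hy ht
  have hinv := integral_mul_cexp_neg_of_integral_mul_cexp
    (Ψ := fun w => ((Real.sinh w * Λ w : ℝ) : ℂ)) (by fun_prop) hΨi.ofReal
    (hodd.ofReal.const_mul (4 * I)) hFT α
  have hsin := integral_ofReal_mul_cexp_of_odd hodd (fun τ => by simp [Kib_neg]) (-α)
  have hL : ∫ τ : ℝ, 4 * I * ((τ * (Kib τ y * Kib τ t) : ℝ) : ℂ) * cexp (-(I * τ * α)) =
      4 * I * ∫ τ : ℝ, ((τ * (Kib τ y * Kib τ t) : ℝ) : ℂ) * cexp (I * (-α : ℝ) * τ) := by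
    rw [← integral_const_mul]
    congr 1 with τ
    rw [mul_assoc]
    push_cast
    ring_nf
  have hneg : ∫ τ in Ioi (0 : ℝ), τ * (Kib τ y * Kib τ t) * Real.sin (-α * τ) =
      -∫ τ in Ioi (0 : ℝ), τ * (Kib τ y * Kib τ t) * Real.sin (τ * α) := by
    rw [← integral_neg]
    congr 1 with τ
    rw [neg_mul, Real.sin_neg, mul_comm α]
    ring
  rw [RCLike.ofReal_eq_complex_ofReal] at hinv
  rw [hL, hsin, hneg] at hinv
  have hfin : 8 * ∫ τ in Ioi (0 : ℝ), τ * (Kib τ y * Kib τ t) * Real.sin (τ * α) =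
      2 * π * (Real.sinh α * Λ α) := by
    have : (8 : ℂ) * ((∫ τ in Ioi (0 : ℝ), τ * (Kib τ y * Kib τ t) * Real.sin (τ * α) : ℝ) : ℂ) =
      2 * π * ((Real.sinh α * Λ α : ℝ) : ℂ) := by
      rw [← hinv]
      generalize (∫ τ in Ioi (0 : ℝ), τ * (Kib τ y * Kib τ t) * Real.sin (τ * α)) = X
      push_cast
      linear_combination (8 : ℂ) * X * Complex.I_sq
    exact_mod_cast this
  linarith

lemma integrableOn_mul_sinh_mul_exp {δ : ℝ} (hδ : π < 3 * δ) :
    IntegrableOn (fun τ : ℝ => τ * Real.sinh (π * τ) * Real.exp (-(τ * δ)) ^ 3) (Ioi 0) := by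
  have h := integrableOn_rpow_mul_exp_neg_mul_rpow (p := 1) (s := 1) (b := 3 * δ - π)
    (by norm_num) one_pos (by linarith)
  refine Integrable.mono' h (by fun_prop : Continuous _).aestronglyMeasurable ?_
  filter_upwards [ae_restrict_mem measurableSet_Ioi] with τ hτ
  have hτ' : 0 < τ := hτ
  have hs : 0 ≤ Real.sinh (π * τ) := Real.sinh_nonneg_iff.2 (by positivity)
  have hs' : Real.sinh (π * τ) ≤ Real.exp (π * τ) := by
    rw [Real.sinh_eq]
    linarith [Real.exp_pos (π * τ), Real.exp_pos (-(π * τ))]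
  rw [Real.norm_of_nonneg (by positivity), Real.rpow_one, mul_assoc]
  gcongr
  calc Real.sinh (π * τ) * Real.exp (-(τ * δ)) ^ 3
      ≤ Real.exp (π * τ) * Real.exp (-(τ * δ)) ^ 3 := by gcongr
    _ = Real.exp (-(3 * δ - π) * τ) := by
      rw [← Real.exp_nat_mul, ← Real.exp_add]
      congr 1
      push_cast
      ring

lemma abs_mul_sinh_mul_Kib_le {p τ x y t : ℝ} (hp : 0 < p) (hp1 : p ≤ 1) (hτ : 0 < τ)
    (hx : 0 < x) (hy : 0 < y) (ht : 0 < t) :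
    |τ * Real.sinh (π * τ) * Kib τ x * (Kib τ y * Kib τ t)| ≤
      τ * Real.sinh (π * τ) * Real.exp (-(τ * arccos p)) ^ 3 *
        (K0 (p * x) * (K0 (p * y) * K0 (p * t))) := by
  have hs : 0 ≤ Real.sinh (π * τ) := Real.sinh_nonneg_iff.2 (by positivity)
  have hx0 := K0_nonneg (p * x)
  have hy0 := K0_nonneg (p * y)
  have ht0 := K0_nonneg (p * t)
  rw [abs_mul, abs_mul, abs_mul, abs_mul, abs_of_pos hτ, abs_of_nonneg hs]
  calc _ ≤ τ * Real.sinh (π * τ) * (Real.exp (-(τ * arccos p)) * K0 (p * x)) *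
        ((Real.exp (-(τ * arccos p)) * K0 (p * y)) * (Real.exp (-(τ * arccos p)) * K0 (p * t))) := by
        gcongr
        exacts [abs_Kib_le hp hp1 τ hx, abs_Kib_le hp hp1 τ hy, abs_Kib_le hp hp1 τ ht]
    _ = _ := by ring

lemma K0_anti {a b : ℝ} (ha : 0 < a) (hab : a ≤ b) : K0 b ≤ K0 a := by
  refine integral_mono (integrable_exp_neg_mul_cosh (ha.trans_le hab)).integrableOn
    (integrable_exp_neg_mul_cosh ha).integrableOn fun u => ?_
  have := Real.cosh_pos u
  simp only [Real.exp_le_exp]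
  nlinarith

lemma measurable_Kib_left (x : ℝ) : Measurable fun τ => Kib τ x :=
  measurable_Kib.comp (measurable_id.prodMk measurable_const)

lemma continuousAt_Kib (τ : ℝ) {x : ℝ} (hx : 0 < x) : ContinuousAt (Kib τ) x := by
  refine continuousAt_of_dominated (bound := fun u => Real.exp (-(x / 2) * Real.cosh u))
    (.of_forall fun z => (by fun_prop : Continuous _).aestronglyMeasurable) ?_
    (integrable_exp_neg_mul_cosh (half_pos hx)).integrableOn
    (.of_forall fun u => by fun_prop)
  filter_upwards [lt_mem_nhds (half_lt_self hx)] with z hz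
  refine .of_forall fun u => ?_
  rw [norm_mul, Real.norm_eq_abs, Real.norm_eq_abs, Real.abs_exp]
  refine (mul_le_of_le_one_right (Real.exp_pos _).le (Real.abs_cos_le_one _)).trans ?_
  have := Real.cosh_pos u
  rw [Real.exp_le_exp]
  nlinarith

lemma pi_lt_three_mul_arccos {p : ℝ} (hp0 : 0 < p) (hp : p < 1 / 2) : π < 3 * arccos p := by
  linarith [pi_div_three_lt_arccos hp0 hp]

lemma continuousOn_integral_mul_sinh_mul_Kib {y t : ℝ} (hy : 0 < y) (ht : 0 < t) :
    ContinuousOn (fun x => ∫ τ in Ioi (0 : ℝ),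
      τ * Real.sinh (π * τ) * Kib τ x * (Kib τ y * Kib τ t)) (Ioi 0) := by
  intro x hx
  have hx' : 0 < x := hx
  have hp := pi_lt_three_mul_arccos (p := 1 / 4) (by norm_num) (by norm_num)
  refine ContinuousAt.continuousWithinAt (continuousAt_of_dominated
    (bound := fun τ => τ * Real.sinh (π * τ) * Real.exp (-(τ * arccos (1 / 4))) ^ 3 *
        (K0 (1 / 4 * (x / 2)) * (K0 (1 / 4 * y) * K0 (1 / 4 * t))))
    (.of_forall fun z => ?_) ?_ ((integrableOn_mul_sinh_mul_exp hp).mul_const _) ?_)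
  · have h1 := measurable_Kib_left z
    have h2 := measurable_Kib_left y
    have h3 := measurable_Kib_left t
    exact (by fun_prop : Measurable _).aestronglyMeasurable
  · filter_upwards [lt_mem_nhds (half_lt_self hx')] with z hz
    filter_upwards [ae_restrict_mem measurableSet_Ioi] with τ hτ
    have hτ' : 0 < τ := hτ
    refine (abs_mul_sinh_mul_Kib_le (p := 1 / 4) (by norm_num) (by norm_num) hτ
      ((half_pos hx').trans hz) hy ht).trans ?_
    have hs : 0 ≤ Real.sinh (π * τ) := Real.sinh_nonneg_iff.2 (by positivity)
    have hy0 := K0_nonneg (1 / 4 * y)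
    have ht0 := K0_nonneg (1 / 4 * t)
    gcongr
    exact K0_anti (by positivity) (by linarith)
  · refine .of_forall fun τ => ?_
    have := continuousAt_Kib τ hx'
    fun_prop

lemma integrable_exp_mul_sinh_mul_Kib {s y t : ℝ} (hs : 0 ≤ s) (hy : 0 < y) (ht : 0 < t) :
    Integrable (fun z : ℝ × ℝ => Real.exp (-s * z.1) *
      (z.2 * Real.sinh (π * z.2) * Kib z.2 z.1 * (Kib z.2 y * Kib z.2 t)))
      ((volume.restrict (Ioi 0)).prod (volume.restrict (Ioi 0))) := by
  have hp := pi_lt_three_mul_arccos (p := 1 / 4) (by norm_num) (by norm_num)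
  have hdom := (integrableOn_exp_mul_K0 hs (p := 1 / 4) (by norm_num)).mul_prod
    ((integrableOn_mul_sinh_mul_exp hp).mul_const (K0 (1 / 4 * y) * K0 (1 / 4 * t)))
  refine hdom.mono' ?_ ?_
  · have h1 : Measurable fun z : ℝ × ℝ => Kib z.2 z.1 := measurable_Kib.comp measurable_swap
    have h2 : Measurable fun z : ℝ × ℝ => Kib z.2 y := (measurable_Kib_left y).comp measurable_snd
    have h3 : Measurable fun z : ℝ × ℝ => Kib z.2 t := (measurable_Kib_left t).comp measurable_snd
    exact (by fun_prop : Measurable _).aestronglyMeasurable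
  · rw [Measure.prod_restrict]
    filter_upwards [ae_restrict_mem (measurableSet_Ioi.prod measurableSet_Ioi)] with z hz
    rw [norm_mul, Real.norm_eq_abs, Real.norm_eq_abs, Real.abs_exp]
    refine (mul_le_mul_of_nonneg_left (abs_mul_sinh_mul_Kib_le (p := 1 / 4) (by norm_num)
      (by norm_num) hz.2 hz.1 hy ht) (Real.exp_pos _).le).trans_eq ?_
    ring

lemma laplace_integral_mul_sinh_mul_Kib {y t α : ℝ} (hy : 0 < y) (ht : 0 < t) (hα : 0 < α) :
    ∫ x in Ioi (0 : ℝ), Real.exp (-Real.cosh α * x) * (∫ τ in Ioi (0 : ℝ),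
      τ * Real.sinh (π * τ) * Kib τ x * (Kib τ y * Kib τ t)) =
    ∫ x in Ioi (0 : ℝ), Real.exp (-Real.cosh α * x) * (π ^ 2 / 4 *
      Real.exp (-((y ^ 2 + t ^ 2) / (2 * y * t)) * x - y * t / 2 / x)) := by
  have hsα : Real.sinh α ≠ 0 := (Real.sinh_pos_iff.2 hα).ne'
  simp_rw [← integral_const_mul]
  rw [integral_integral_swap (integrable_exp_mul_sinh_mul_Kib (Real.cosh_pos α).le hy ht)]
  have h : ∀ τ ∈ Ioi (0 : ℝ), ∫ x in Ioi (0 : ℝ), Real.exp (-Real.cosh α * x) *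
      (τ * Real.sinh (π * τ) * Kib τ x * (Kib τ y * Kib τ t)) =
      π / Real.sinh α * (τ * (Kib τ y * Kib τ t) * Real.sin (τ * α)) := by
    intro τ hτ
    have hτ' : 0 < τ := hτ
    have hsτ : Real.sinh (π * τ) ≠ 0 := (Real.sinh_pos_iff.2 (by positivity)).ne'
    have h1 : ∀ x : ℝ, Real.exp (-Real.cosh α * x) *
      (τ * Real.sinh (π * τ) * Kib τ x * (Kib τ y * Kib τ t)) =
      τ * Real.sinh (π * τ) * (Kib τ y * Kib τ t) * (Real.exp (-Real.cosh α * x) * Kib τ x) :=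
      fun x => by ring
    simp_rw [h1]
    rw [integral_const_mul, integral_exp_mul_Kib τ (Real.cosh_pos α).le,
      integral_inv_cosh_add_cosh_mul_cos hτ'.ne' hα]
    field_simp
  rw [setIntegral_congr_fun measurableSet_Ioi h, integral_const_mul,
    integral_mul_Kib_mul_Kib_mul_sin hy ht, ← mul_assoc, ← mul_assoc,
    ← integral_const_mul]
  congr 1 with x
  rw [mul_comm (-x) (Real.cosh α), mul_neg, ← neg_mul]
  field_simp

lemma integral_eval_exp_neg_mul_eq_zero {φ : ℝ → ℝ} (hφ : IntegrableOn φ (Ioi 0))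
    (h : ∀ s : ℝ, 1 < s → ∫ x in Ioi (0 : ℝ), Real.exp (-s * x) * φ x = 0) (P : Polynomial ℝ) :
    ∫ x in Ioi (0 : ℝ), Real.exp (-2 * x) * P.eval (Real.exp (-x)) * φ x = 0 := by
  have h1 : ∀ x : ℝ, Real.exp (-2 * x) * P.eval (Real.exp (-x)) * φ x =
      ∑ n ∈ Finset.range (P.natDegree + 1),
        P.coeff n * (Real.exp (-((n : ℝ) + 2) * x) * φ x) := by
    intro x
    rw [Polynomial.eval_eq_sum_range, Finset.mul_sum, Finset.sum_mul]
    refine Finset.sum_congr rfl fun n _ => ?_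
    rw [show -((n : ℝ) + 2) * x = -2 * x + n * -x by ring, Real.exp_add, Real.exp_nat_mul]
    ring
  simp_rw [h1]
  rw [integral_finsetSum]
  · refine Finset.sum_eq_zero fun n _ => ?_
    rw [integral_const_mul, h _ (by linarith [n.cast_nonneg (α := ℝ)]), mul_zero]
  · intro n _
    refine Integrable.const_mul (hφ.bdd_mul (c := 1) (by fun_prop) ?_) _
    filter_upwards [ae_restrict_mem measurableSet_Ioi] with x hx
    have hx' : 0 < x := hx
    rw [Real.norm_eq_abs, Real.abs_exp, Real.exp_le_one_iff]
    have : (0 : ℝ) ≤ n := n.cast_nonneg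
    nlinarith [mul_nonneg this hx'.le]

lemma continuous_comp_neg_log_div_sq {ψ : ℝ → ℝ} (hψ : Continuous ψ)
    (hs : HasCompactSupport ψ) : Continuous fun q : ℝ => ψ (-Real.log q) / q ^ 2 := by
  rw [continuous_iff_continuousAt]
  intro q
  rcases eq_or_ne q 0 with rfl | hq
  · obtain ⟨M, hM⟩ := hs.isCompact.isBounded.subset_closedBall 0
    have hlog : ∀ᶠ r in 𝓝[≠] (0 : ℝ), Real.log r < -M :=
      Real.tendsto_log_nhdsNE_zero.eventually_lt_atBot _
    have hev : (fun q : ℝ => ψ (-Real.log q) / q ^ 2) =ᶠ[𝓝 0] fun _ => 0 := by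
      rw [eventually_nhdsWithin_iff] at hlog
      filter_upwards [hlog] with r hr
      rcases eq_or_ne r 0 with rfl | hr0
      · simp
      · have : -Real.log r ∉ tsupport ψ := fun hmem => by
          have := hM hmem
          rw [mem_closedBall_zero_iff, Real.norm_eq_abs] at this
          linarith [le_abs_self (-Real.log r), hr hr0]
        rw [image_eq_zero_of_notMem_tsupport this, zero_div]
    exact continuousAt_const.congr hev.symm
  · have := Real.continuousAt_log hq
    exact (hψ.continuousAt.comp this.neg).div (by fun_prop) (by positivity)

/-- Uniqueness of the Laplace transform for continuous integrable functions. -/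
lemma eq_zero_of_laplace_eq_zero {φ : ℝ → ℝ} (hφ : IntegrableOn φ (Ioi 0))
    (hc : ContinuousOn φ (Ioi 0))
    (h : ∀ s : ℝ, 1 < s → ∫ x in Ioi (0 : ℝ), Real.exp (-s * x) * φ x = 0)
    {x : ℝ} (hx : 0 < x) : φ x = 0 := by
  have hae := isOpen_Ioi.ae_eq_zero_of_integral_contDiff_smul_eq_zero (U := Ioi (0 : ℝ))
    (μ := volume) (f := φ) hφ.locallyIntegrableOn ?_
  · have hae' : φ =ᵐ[volume.restrict (Ioi 0)] fun _ => (0 : ℝ) :=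
      (ae_restrict_iff' measurableSet_Ioi).2 hae
    exact Measure.eqOn_open_of_ae_eq hae' isOpen_Ioi hc continuousOn_const hx
  · intro ψ hψ hs hsupp
    have h0 : ∀ z, z ∉ Ioi (0 : ℝ) → ψ z = 0 := fun z hz =>
      image_eq_zero_of_notMem_tsupport fun hm => hz (hsupp hm)
    have hψc := hψ.continuous
    have hset : ∫ z, ψ z • φ z = ∫ z in Ioi (0 : ℝ), ψ z * φ z := by
      symm
      refine setIntegral_eq_integral_of_forall_compl_eq_zero fun z hz => ?_
      rw [h0 z hz, zero_mul]
    rw [hset]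
    obtain ⟨C, hC⟩ := hψc.bounded_above_of_compact_support hs
    have hbd : ∀ ε : ℝ, 0 < ε → |∫ z in Ioi (0 : ℝ), ψ z * φ z| ≤
        ε * ∫ z in Ioi (0 : ℝ), |φ z| := by
      intro ε hε
      obtain ⟨P, hP⟩ := exists_polynomial_near_of_continuousOn 0 1
        (fun q => ψ (-Real.log q) / q ^ 2)
        (continuous_comp_neg_log_div_sq hψc hs).continuousOn ε hε
      have hclose : ∀ z ∈ Ioi (0 : ℝ),
          |Real.exp (-2 * z) * P.eval (Real.exp (-z)) - ψ z| ≤ ε := by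
        intro z hz
        have hz' : 0 < z := hz
        have h1 := hP (Real.exp (-z)) ⟨(Real.exp_pos _).le, Real.exp_le_one_iff.2 (by linarith)⟩
        rw [Real.log_exp, neg_neg, ← Real.exp_nat_mul] at h1
        have h2 : Real.exp ((2 : ℕ) * -z) = Real.exp (-2 * z) := by
          congr 1
          push_cast
          ring
        rw [h2] at h1
        have h3 : Real.exp (-2 * z) * P.eval (Real.exp (-z)) - ψ z =
            Real.exp (-2 * z) * (P.eval (Real.exp (-z)) - ψ z / Real.exp (-2 * z)) := by
          field_simp
        rw [h3, abs_mul, Real.abs_exp]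
        have h4 : Real.exp (-2 * z) ≤ 1 := Real.exp_le_one_iff.2 (by linarith)
        calc _ ≤ 1 * ε := by gcongr
          _ = ε := one_mul ε
      have hi1 : IntegrableOn (fun z => (Real.exp (-2 * z) * P.eval (Real.exp (-z)) - ψ z) * φ z)
          (Ioi 0) := by
        refine hφ.bdd_mul (c := ε) ?_ ?_
        · have := P.continuous
          exact (by fun_prop : Continuous _).aestronglyMeasurable
        · filter_upwards [ae_restrict_mem measurableSet_Ioi] with z hz
          exact hclose z hz
      have hi2 : IntegrableOn (fun z => ψ z * φ z) (Ioi 0) :=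
        hφ.bdd_mul (c := C) hψc.aestronglyMeasurable (.of_forall hC)
      have hsum : ∫ z in Ioi (0 : ℝ),
          (Real.exp (-2 * z) * P.eval (Real.exp (-z)) - ψ z) * φ z =
          -∫ z in Ioi (0 : ℝ), ψ z * φ z := by
        rw [eq_neg_iff_add_eq_zero, ← integral_add hi1 hi2]
        refine Eq.trans ?_ (integral_eval_exp_neg_mul_eq_zero hφ h P)
        congr 1 with z
        ring
      rw [← abs_neg, ← hsum, ← integral_const_mul]
      refine (norm_integral_le_integral_norm _).trans
        (setIntegral_mono_on hi1.norm (hφ.abs.const_mul ε) measurableSet_Ioi fun z hz => ?_)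
      rw [norm_mul]
      exact mul_le_mul_of_nonneg_right (hclose z hz) (norm_nonneg _)
    rw [← abs_nonpos_iff]
    set A := ∫ z in Ioi (0 : ℝ), |φ z|
    have hA : 0 ≤ A := integral_nonneg fun z => abs_nonneg _
    refine le_of_forall_pos_le_add fun ε hε => ?_
    refine (hbd (ε / (A + 1)) (by positivity)).trans ?_
    rw [zero_add, div_mul_eq_mul_div, div_le_iff₀ (by positivity)]
    nlinarith

/-- The index integral of a product of three modified Bessel functions of imaginary order. -/
lemma integral_mul_sinh_mul_Kib_mul_Kib_mul_Kib {x y t : ℝ} (hx : 0 < x) (hy : 0 < y)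
    (ht : 0 < t) :
    ∫ τ in Ioi (0 : ℝ), τ * Real.sinh (π * τ) * Kib τ x * (Kib τ y * Kib τ t) =
      π ^ 2 / 4 * Real.exp (-((y ^ 2 + t ^ 2) / (2 * y * t)) * x - y * t / 2 / x) := by
  have hI1 : IntegrableOn (fun x => ∫ τ in Ioi (0 : ℝ),
      τ * Real.sinh (π * τ) * Kib τ x * (Kib τ y * Kib τ t)) (Ioi 0) := by
    have := (integrable_exp_mul_sinh_mul_Kib le_rfl hy ht).integral_prod_left
    simpa [IntegrableOn] using this
  have hI2 : IntegrableOn (fun x => π ^ 2 / 4 *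
      Real.exp (-((y ^ 2 + t ^ 2) / (2 * y * t)) * x - y * t / 2 / x)) (Ioi 0) :=
    (integrableOn_exp_sub_div (by positivity) (by positivity)).const_mul _
  have hb : ∀ {φ : ℝ → ℝ} {s : ℝ}, 1 < s → IntegrableOn φ (Ioi 0) →
      IntegrableOn (fun x => Real.exp (-s * x) * φ x) (Ioi 0) := by
    intro φ s hs hφ
    refine hφ.bdd_mul (c := 1) (by fun_prop) ?_
    filter_upwards [ae_restrict_mem measurableSet_Ioi] with x hx
    have hx' : 0 < x := hx
    rw [Real.norm_eq_abs, Real.abs_exp, Real.exp_le_one_iff]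
    nlinarith
  refine sub_eq_zero.1 (eq_zero_of_laplace_eq_zero (hI1.sub hI2)
    ((continuousOn_integral_mul_sinh_mul_Kib hy ht).sub ?_) (fun s hs => ?_) hx)
  · refine ContinuousOn.const_mul ?_ _
    refine Real.continuous_exp.comp_continuousOn (ContinuousOn.sub (by fun_prop) ?_)
    exact continuousOn_const.div continuousOn_id fun z hz => (ne_of_gt hz)
  · have hα : 0 < arcosh s := Real.arcosh_pos hs
    have := laplace_integral_mul_sinh_mul_Kib hy ht hα
    rw [Real.cosh_arcosh hs.le] at this
    simp only [Pi.sub_apply, mul_sub]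
    rw [integral_sub (hb hs hI1) (hb hs hI2), this, sub_self]

lemma integrable_mul_sinh_mul_Kib_mul {p x : ℝ} (hp0 : 0 < p) (hp1 : p < 1 / 2) (hx : 0 < x)
    {f g : ℝ → ℂ} (hfm : Measurable f) (hgm : Measurable g)
    (hf : IntegrableOn (fun x => K0 (p * x) * ‖f x‖) (Ioi 0))
    (hg : IntegrableOn (fun x => K0 (p * x) * ‖g x‖) (Ioi 0)) :
    Integrable (fun z : (ℝ × ℝ) × ℝ => ((z.2 * Real.sinh (π * z.2) * Kib z.2 x : ℝ) : ℂ) *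
      (((Kib z.2 z.1.1 : ℝ) : ℂ) * f z.1.1 * (((Kib z.2 z.1.2 : ℝ) : ℂ) * g z.1.2)))
      (((volume.restrict (Ioi 0)).prod (volume.restrict (Ioi 0))).prod
        (volume.restrict (Ioi 0))) := by
  have hdom := (hf.mul_prod hg).mul_prod
    ((integrableOn_mul_sinh_mul_exp (pi_lt_three_mul_arccos hp0 hp1)).mul_const (K0 (p * x)))
  refine hdom.mono' ?_ ?_
  · have h1 : Measurable fun z : (ℝ × ℝ) × ℝ => Kib z.2 x :=
      (measurable_Kib_left x).comp measurable_snd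
    have h2 : Measurable fun z : (ℝ × ℝ) × ℝ => Kib z.2 z.1.1 :=
      measurable_Kib.comp (by fun_prop : Measurable fun z : (ℝ × ℝ) × ℝ => (z.2, z.1.1))
    have h3 : Measurable fun z : (ℝ × ℝ) × ℝ => Kib z.2 z.1.2 :=
      measurable_Kib.comp (by fun_prop : Measurable fun z : (ℝ × ℝ) × ℝ => (z.2, z.1.2))
    exact (by fun_prop : Measurable _).aestronglyMeasurable
  · rw [Measure.prod_restrict, Measure.prod_restrict]
    filter_upwards [ae_restrict_mem ((measurableSet_Ioi.prod measurableSet_Ioi).prod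
      measurableSet_Ioi)] with z hz
    have h := mul_le_mul_of_nonneg_right (abs_mul_sinh_mul_Kib_le hp0 (by linarith) hz.2 hx
      hz.1.1 hz.1.2) (by positivity : 0 ≤ ‖f z.1.1‖ * ‖g z.1.2‖)
    rw [abs_mul, abs_mul] at h
    simp only [norm_mul, Complex.norm_real, Real.norm_eq_abs] at h ⊢
    rw [abs_mul, abs_mul] at *
    refine le_trans (le_of_eq ?_) (h.trans (le_of_eq ?_)) <;> ring

lemma exp_mul_mul_eq_integral {x y t : ℝ} (hx : 0 < x) (hy : 0 < y) (ht : 0 < t) (a b : ℂ) :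
    (Real.exp (-((y ^ 2 + t ^ 2) / (2 * y * t)) * x - y * t / (2 * x)) : ℂ) * a * b =
      ((4 / π ^ 2 : ℝ) : ℂ) * ∫ τ in Ioi (0 : ℝ),
        ((τ * Real.sinh (π * τ) * Kib τ x : ℝ) : ℂ) * (((Kib τ y : ℝ) : ℂ) * a *
          (((Kib τ t : ℝ) : ℂ) * b)) := by
  have h1 : ∀ τ : ℝ, ((τ * Real.sinh (π * τ) * Kib τ x : ℝ) : ℂ) * (((Kib τ y : ℝ) : ℂ) * a *
      (((Kib τ t : ℝ) : ℂ) * b)) =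
      ((τ * Real.sinh (π * τ) * Kib τ x * (Kib τ y * Kib τ t) : ℝ) : ℂ) * (a * b) := fun τ => by
    push_cast
    ring
  simp_rw [h1]
  rw [integral_mul_const, integral_complex_ofReal,
    integral_mul_sinh_mul_Kib_mul_Kib_mul_Kib hx hy ht, ← mul_assoc, ← Complex.ofReal_mul,
    ← mul_assoc, ← mul_assoc, div_div]
  congr 3
  field_simp

end Auxiliary

theorem KL_conv_parseval (p : ℝ) (hp0 : 0 < p) (hp1 : p < 1/2) (f g : ℝ → ℂ)
    (hfm : Measurable f) (hgm : Measurable g)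
    (hf : IntegrableOn (fun x => K0 (p*x) * ‖f x‖) (Ioi 0))
    (hg : IntegrableOn (fun x => K0 (p*x) * ‖g x‖) (Ioi 0)) :
    ∀ x : ℝ, 0 < x →
      KLconv f g x = ((2/(x*π^2) : ℝ) : ℂ) *
        ∫ τ in Ioi (0:ℝ), ((τ * Real.sinh (π*τ) * Kib τ x : ℝ) : ℂ) * KL f τ * KL g τ := by
  intro x hx
  have hI := integrable_mul_sinh_mul_Kib_mul hp0 hp1 hx hfm hgm hf hg
  have hkernel : ∫ y in Ioi (0 : ℝ), ∫ t in Ioi (0 : ℝ),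
      (Real.exp (-((y^2+t^2)/(2*y*t))*x - y*t/(2*x)) : ℂ) * f y * g t =
      ∫ y in Ioi (0 : ℝ), ∫ t in Ioi (0 : ℝ), ((4 / π ^ 2 : ℝ) : ℂ) * ∫ τ in Ioi (0 : ℝ),
        ((τ * Real.sinh (π * τ) * Kib τ x : ℝ) : ℂ) * (((Kib τ y : ℝ) : ℂ) * f y *
          (((Kib τ t : ℝ) : ℂ) * g t)) :=
    setIntegral_congr_fun measurableSet_Ioi fun y hy =>
      setIntegral_congr_fun measurableSet_Ioi fun t ht => exp_mul_mul_eq_integral hx hy ht _ _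
  have hswap : ∫ y in Ioi (0 : ℝ), ∫ t in Ioi (0 : ℝ), ∫ τ in Ioi (0 : ℝ),
        ((τ * Real.sinh (π * τ) * Kib τ x : ℝ) : ℂ) * (((Kib τ y : ℝ) : ℂ) * f y *
          (((Kib τ t : ℝ) : ℂ) * g t)) =
      ∫ τ in Ioi (0 : ℝ), ((τ * Real.sinh (π*τ) * Kib τ x : ℝ) : ℂ) * KL f τ * KL g τ := by
    rw [← integral_prod (fun z : ℝ × ℝ => ∫ τ in Ioi (0 : ℝ),
        ((τ * Real.sinh (π * τ) * Kib τ x : ℝ) : ℂ) * (((Kib τ z.1 : ℝ) : ℂ) * f z.1 *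
          (((Kib τ z.2 : ℝ) : ℂ) * g z.2))) hI.integral_prod_left, integral_integral_swap hI]
    congr 1 with τ
    rw [integral_const_mul, integral_prod_mul (fun y => ((Kib τ y : ℝ) : ℂ) * f y)
      (fun t => ((Kib τ t : ℝ) : ℂ) * g t), ← mul_assoc]
    rfl
  rw [KLconv, hkernel]
  simp_rw [integral_const_mul]
  rw [hswap, ← mul_assoc]
  congr 1
  have hπ : (π : ℂ) ≠ 0 := by exact_mod_cast Real.pi_ne_zero
  have hxc : (x : ℂ) ≠ 0 := by exact_mod_cast hx.ne'
  push_cast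
  field_simp
  norm_num
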